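/- Simulation of detour reduction by βη-reduction: for all λ^{□→∧∨}-terms t and s with t >_D s, (1) for every λ-term r of simple type theory, (t : r) reduces to (s : r) in at least one βη-step, i.e. (t : r) ⟶⁺_{βη} (s : r); and (2) t̿ ⟶⁺_{βη} s̿. -/

import Mathlib

namespace IEL

/-- de Bruijn lifting of a renaming under `n` extra binders. -/
def liftRen (n : ℕ) (f : ℕ → ℕ) : ℕ → ℕ :=
  fun j => if j < n then j else f (j - n) + n

/-- Terms of the calculus `λ^{□→∧∨}` in de Bruijn representation.
In `box ts s`, the body `s` is under `ts.length` binders: de Bruijn index `j` in `s`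
refers to the binding for `ts[ts.length - 1 - j]` (i.e. `x₁` is the outermost binder). -/
inductive Tm : Type where
  | var : ℕ → Tm
  | lam : Tm → Tm
  | app : Tm → Tm → Tm
  | pair : Tm → Tm → Tm
  | proj1 : Tm → Tm
  | proj2 : Tm → Tm
  | inl : Tm → Tm
  | inr : Tm → Tm
  | case : Tm → Tm → Tm → Tm
  | box : List Tm → Tm → Tm

def Tm.rename (f : ℕ → ℕ) : Tm → Tm
  | .var n => .var (f n)
  | .lam t => .lam (t.rename (liftRen 1 f))
  | .app t s => .app (t.rename f) (s.rename f)
  | .pair t s => .pair (t.rename f) (s.rename f)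
  | .proj1 t => .proj1 (t.rename f)
  | .proj2 t => .proj2 (t.rename f)
  | .inl t => .inl (t.rename f)
  | .inr t => .inr (t.rename f)
  | .case t a b => .case (t.rename f) (a.rename (liftRen 1 f)) (b.rename (liftRen 1 f))
  | .box ts s => .box (ts.attach.map fun x => x.1.rename f) (s.rename (liftRen ts.length f))
termination_by t => sizeOf t
decreasing_by all_goals simp_wf <;> ((try have := List.sizeOf_lt_of_mem x.2); omega)

def liftSub (n : ℕ) (σ : ℕ → Tm) : ℕ → Tm :=
  fun j => if j < n then .var j else (σ (j - n)).rename (· + n)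

def Tm.subst (σ : ℕ → Tm) : Tm → Tm
  | .var n => σ n
  | .lam t => .lam (t.subst (liftSub 1 σ))
  | .app t s => .app (t.subst σ) (s.subst σ)
  | .pair t s => .pair (t.subst σ) (s.subst σ)
  | .proj1 t => .proj1 (t.subst σ)
  | .proj2 t => .proj2 (t.subst σ)
  | .inl t => .inl (t.subst σ)
  | .inr t => .inr (t.subst σ)
  | .case t a b => .case (t.subst σ) (a.subst (liftSub 1 σ)) (b.subst (liftSub 1 σ))
  | .box ts s => .box (ts.attach.map fun x => x.1.subst σ) (s.subst (liftSub ts.length σ))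
termination_by t => sizeOf t
decreasing_by all_goals simp_wf <;> ((try have := List.sizeOf_lt_of_mem x.2); omega)

/-- `t.subst1 s` is `t[x₀ := s]`. -/
def Tm.subst1 (t s : Tm) : Tm :=
  t.subst (fun j => match j with | 0 => s | j+1 => .var j)

/-- Compatible (contextual) closure of a base relation `R`. -/
inductive Compat (R : Tm → Tm → Prop) : Tm → Tm → Prop where
  | base {t s} : R t s → Compat R t s
  | lam {t t'} : Compat R t t' → Compat R (.lam t) (.lam t')
  | appL {t t' s} : Compat R t t' → Compat R (.app t s) (.app t' s)
  | appR {t s s'} : Compat R s s' → Compat R (.app t s) (.app t s')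
  | pairL {t t' s} : Compat R t t' → Compat R (.pair t s) (.pair t' s)
  | pairR {t s s'} : Compat R s s' → Compat R (.pair t s) (.pair t s')
  | proj1 {t t'} : Compat R t t' → Compat R (.proj1 t) (.proj1 t')
  | proj2 {t t'} : Compat R t t' → Compat R (.proj2 t) (.proj2 t')
  | inl {t t'} : Compat R t t' → Compat R (.inl t) (.inl t')
  | inr {t t'} : Compat R t t' → Compat R (.inr t) (.inr t')
  | case1 {t t' a b} : Compat R t t' → Compat R (.case t a b) (.case t' a b)
  | case2 {t a a' b} : Compat R a a' → Compat R (.case t a b) (.case t a' b)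
  | case3 {t a b b'} : Compat R b b' → Compat R (.case t a b) (.case t a b')
  | boxArg {t t' l₁ l₂ s} : Compat R t t' →
      Compat R (.box (l₁ ++ t :: l₂) s) (.box (l₁ ++ t' :: l₂) s)
  | boxBody {ts s s'} : Compat R s s' → Compat R (.box ts s) (.box ts s')

/-- Renaming used when the body `v` of an inner box is substituted into the outer body:
`v` has `m` bound variables (sent to positions `i, …, i+m-1`) and its ambient free
variables are shifted below the `n - 1 + m` binders of the contractum. -/
def boxRho (i m n : ℕ) : ℕ → ℕ := fun k => if k < m then i + k else k + n - 1

/-- The substitution performed in the box/box detour: the bound variable at de Bruijn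
index `i` is replaced by `v` (suitably renamed), the remaining bound variables are
re-addressed for the enlarged binder list. -/
def boxSigma (i m n : ℕ) (v : Tm) : ℕ → Tm :=
  fun j => if j < i then .var j else if j = i then v.rename (boxRho i m n) else .var (j + m - 1)

/-- Root detour conversions. -/
inductive DRed : Tm → Tm → Prop where
  | beta {t s} : DRed (.app (.lam t) s) (t.subst1 s)
  | projPair1 {t s} : DRed (.proj1 (.pair t s)) t
  | projPair2 {t s} : DRed (.proj2 (.pair t s)) s
  | caseInl {t a b} : DRed (.case (.inl t) a b) (a.subst1 t)
  | caseInr {t a b} : DRed (.case (.inr t) a b) (b.subst1 t)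
  | boxBox {l₁ l₂ us v r} :
      DRed (.box (l₁ ++ (.box us v) :: l₂) r)
           (.box (l₁ ++ us ++ l₂)
                 (r.subst (boxSigma l₂.length us.length (l₁.length + 1 + l₂.length) v)))
  | boxVar {t} : DRed (.box [t] (.var 0)) t

/-- One-step detour reduction `>_D`: the compatible closure of the root detours. -/
def StepD : Tm → Tm → Prop := Compat DRed

/-- Terms of simple type theory (the pure λ-calculus), de Bruijn representation. -/
inductive L : Type where
  | var : ℕ → L
  | lam : L → L
  | app : L → L → L

def L.rename (f : ℕ → ℕ) : L → L
  | .var n => .var (f n)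
  | .lam t => .lam (t.rename (liftRen 1 f))
  | .app t s => .app (t.rename f) (s.rename f)

def liftSubL (n : ℕ) (σ : ℕ → L) : ℕ → L :=
  fun j => if j < n then .var j else (σ (j - n)).rename (· + n)

def L.subst (σ : ℕ → L) : L → L
  | .var n => σ n
  | .lam t => .lam (t.subst (liftSubL 1 σ))
  | .app t s => .app (t.subst σ) (s.subst σ)

/-- `t.subst1 s` is `t[x₀ := s]`. -/
def L.subst1 (t s : L) : L :=
  t.subst (fun j => match j with | 0 => s | j + 1 => .var j)

/-- One-step βη-reduction of the pure λ-calculus (compatible closure of β and η). -/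
inductive LStep : L → L → Prop where
  | beta {t s} : LStep (.app (.lam t) s) (t.subst1 s)
  | eta {t} : LStep (.lam (.app (t.rename (· + 1)) (.var 0))) t
  | lam {t t'} : LStep t t' → LStep (.lam t) (.lam t')
  | appL {t t' s} : LStep t t' → LStep (.app t s) (.app t' s)
  | appR {t s s'} : LStep s s' → LStep (.app t s) (.app t s')

/-- `⟶⁺_{βη}`: at least one βη-step. -/
def LStepPlus : L → L → Prop := Relation.TransGen LStep

/-- Shift a source-to-target renaming under `d` target-only binders. -/
def sh (d : ℕ) (f : ℕ → ℕ) : ℕ → ℕ := fun j => f j + d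

/-- Extend a source-to-target renaming under one binder binding source index 0. -/
def lift1 (f : ℕ → ℕ) : ℕ → ℕ := fun j => match j with | 0 => 0 | j + 1 => f j + 1

/- The infix operator `(t : r)` of the modified CPS translation, parametrized by a
renaming `f` of the ambient free source variables (the operator of the paper is
`colon id`); `mcps` is the modified CPS translation `t̿ = λk.(t : k)`. -/
mutual
def colon (f : ℕ → ℕ) : Tm → L → L
  | .var n, r => .app (.var (f n)) r
  | .lam t, r => .app r (.lam (mcps (lift1 f) t))
  | .app t s, r => colon f t
      (.lam (.app (.app (.var 0) (mcps (sh 1 f) s)) (r.rename (· + 1))))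
  | .pair t s, r => .app r
      (.lam (.app (.app (.var 0) (mcps (sh 1 f) t)) (mcps (sh 1 f) s)))
  | .proj1 t, r => colon f t
      (.lam (.app (.var 0) (.lam (.lam (.app (.var 1) (r.rename (· + 3)))))))
  | .proj2 t, r => colon f t
      (.lam (.app (.var 0) (.lam (.lam (.app (.var 0) (r.rename (· + 3)))))))
  | .inl t, r => .app r (.lam (.lam (.app (.var 1) (mcps (sh 2 f) t))))
  | .inr t, r => .app r (.lam (.lam (.app (.var 0) (mcps (sh 2 f) t))))
  | .case t a b, r => colon f t (.lam (.app
      (.app (.var 0) (.lam (colon (lift1 (sh 1 f)) a (r.rename (· + 2)))))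
      (.lam (colon (lift1 (sh 1 f)) b (r.rename (· + 2))))))
  | .box ts s, r => colonBox f 0 (mcps (liftRen ts.length f) s) ts r
termination_by t r => 2 * sizeOf t
decreasing_by all_goals simp_wf <;> ((try have := List.sizeOf_lt_of_mem x.2); omega)

def colonBox (f : ℕ → ℕ) (d : ℕ) (s' : L) : List Tm → L → L
  | [], r => .app r s'
  | t :: rest, r => colon (sh d f) t (.lam (colonBox f (d + 1) s' rest (r.rename (· + 1))))
termination_by l r => 2 * sizeOf l + 1
decreasing_by all_goals simp_wf <;> omega

def mcps (f : ℕ → ℕ) (t : Tm) : L := .lam (colon (sh 1 f) t (.var 0))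
termination_by 2 * sizeOf t + 1
decreasing_by all_goals simp_wf <;> omega
end

/-! ### Pure lambda calculus metatheory -/

theorem liftRen_comp1 {f g h : ℕ → ℕ} (n : ℕ) (H : ∀ j, f (g j) = h j) (j : ℕ) :
    liftRen n f (liftRen n g j) = liftRen n h j := by
  unfold liftRen
  by_cases hj : j < n
  · simp [hj]
  · simp [hj, H]

theorem L.rename_ext {f g : ℕ → ℕ} (H : ∀ j, f j = g j) (t : L) : t.rename f = t.rename g := by
  rw [funext H]

theorem L.subst_ext {f g : ℕ → L} (H : ∀ j, f j = g j) (t : L) : t.subst f = t.subst g := by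
  rw [funext H]

theorem L.rename_rename (t : L) : ∀ {f g h : ℕ → ℕ}, (∀ j, f (g j) = h j) →
    (t.rename g).rename f = t.rename h := by
  induction t with
  | var n => intro f g h H; simp [L.rename, H]
  | lam t ih => intro f g h H; simp only [L.rename]; rw [ih (liftRen_comp1 1 H)]
  | app t s ih1 ih2 => intro f g h H; simp only [L.rename]; rw [ih1 H, ih2 H]

theorem L.rename_subst (t : L) : ∀ {f : ℕ → ℕ} {τ τ' : ℕ → L}, (∀ j, τ (f j) = τ' j) →
    (t.rename f).subst τ = t.subst τ' := by
  induction t with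
  | var n => intro f g h H; simp [L.rename, L.subst, H]
  | lam t ih =>
    intro f g h H; simp only [L.rename, L.subst]
    rw [ih]
    intro j
    unfold liftRen liftSubL
    by_cases hj : j < 1
    · simp [hj]
    · simp [hj, H]
  | app t s ih1 ih2 => intro f g h H; simp only [L.rename, L.subst]; rw [ih1 H, ih2 H]

theorem L.subst_rename (t : L) : ∀ {f : ℕ → ℕ} {τ τ' : ℕ → L}, (∀ j, (τ j).rename f = τ' j) →
    (t.subst τ).rename f = t.subst τ' := by
  induction t with
  | var n => intro f g h H; simp [L.subst, H]
  | lam t ih =>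
    intro f g h H; simp only [L.rename, L.subst]
    rw [ih]
    intro j
    unfold liftSubL
    by_cases hj : j < 1
    · simp [hj, L.rename, liftRen]
    · simp only [hj, if_false, ← H]
      rw [L.rename_rename (h := fun k => f k + 1), L.rename_rename (h := fun k => f k + 1)]
      · intro j; rfl
      · intro j; simp [liftRen]
  | app t s ih1 ih2 => intro f g h H; simp only [L.rename, L.subst]; rw [ih1 H, ih2 H]

theorem L.subst_var (t : L) : ∀ {τ : ℕ → L}, (∀ j, τ j = .var j) → t.subst τ = t := by
  induction t with
  | var n => intro τ H; simp [L.subst, H]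
  | lam t ih =>
    intro τ H; simp only [L.subst]; rw [ih]
    intro j
    unfold liftSubL
    by_cases hj : j < 1
    · simp [hj]
    · simp only [hj, if_false, H, L.rename]; congr 1; omega
  | app t s ih1 ih2 => intro τ H; simp only [L.subst]; rw [ih1 H, ih2 H]

theorem L.rename_eq_subst (t : L) (f : ℕ → ℕ) : t.rename f = t.subst (fun j => .var (f j)) := by
  rw [← L.subst_var (t.rename f) (τ := .var) (fun _ => rfl)]
  exact L.rename_subst t (fun _ => rfl)

theorem L.rename_id (t : L) {f : ℕ → ℕ} (H : ∀ j, f j = j) : t.rename f = t := by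
  rw [L.rename_eq_subst]; exact L.subst_var t (fun j => by rw [H])

theorem liftSubL_zero (τ : ℕ → L) : liftSubL 0 τ = τ := by
  funext j; simp only [liftSubL, Nat.not_lt_zero, if_false]
  exact L.rename_id _ (fun _ => rfl)

theorem liftSubL_liftSubL (a b : ℕ) (τ : ℕ → L) :
    liftSubL a (liftSubL b τ) = liftSubL (b + a) τ := by
  funext j
  unfold liftSubL
  by_cases h1 : j < a
  · rw [if_pos h1, if_pos (by omega)]
  · rw [if_neg h1]
    by_cases h2 : j - a < b
    · rw [if_pos h2, if_pos (by omega)]; simp only [L.rename]; congr 1; omega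
    · rw [if_neg h2, if_neg (by omega), L.rename_rename (h := (· + (b + a)))]
      · congr 2; omega
      · intro k; omega

theorem L.rename_lift (r : L) (n : ℕ) (τ : ℕ → L) :
    (r.rename (· + n)).subst (liftSubL n τ) = (r.subst τ).rename (· + n) := by
  rw [L.rename_subst (τ' := fun j => (τ j).rename (· + n)),
    L.subst_rename (τ' := fun j => (τ j).rename (· + n))]
  · intro j; rfl
  · intro j; simp [liftSubL]

theorem L.rename_liftRen (r : L) (n : ℕ) (f : ℕ → ℕ) :
    (r.rename (· + n)).rename (liftRen n f) = (r.rename f).rename (· + n) := by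
  rw [L.rename_rename (h := fun j => f j + n), L.rename_rename (h := fun j => f j + n)]
  · intro j; rfl
  · intro j; simp [liftRen]

/-- The one-variable substitution. -/
def one (s : L) : ℕ → L := fun j => match j with | 0 => s | j + 1 => .var j

theorem L.subst1_eq (t s : L) : t.subst1 s = t.subst (one s) := rfl

theorem L.rename_one (r s : L) : (r.rename (· + 1)).subst (one s) = r := by
  rw [L.rename_subst (τ' := fun j => .var j) (f := (· + 1)) r (fun _ => rfl)]; exact L.subst_var r (fun _ => rfl)

theorem LStep.rename {t t' : L} (h : LStep t t') : ∀ f : ℕ → ℕ,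
    LStep (t.rename f) (t'.rename f) := by
  induction h with
  | @beta t s =>
    intro f
    have : (t.subst1 s).rename f = (t.rename (liftRen 1 f)).subst1 (s.rename f) := by
      rw [L.subst1_eq, L.subst1_eq, L.subst_rename t (fun _ => rfl)]
      symm
      apply L.rename_subst
      intro j
      cases j <;> simp [liftRen, one, L.rename]
    rw [this]; exact LStep.beta
  | @eta t =>
    intro f
    simp only [L.rename]
    rw [L.rename_liftRen]
    exact LStep.eta
  | lam _ ih => intro f; exact .lam (ih _)
  | appL _ ih => intro f; exact .appL (ih _)
  | appR _ ih => intro f; exact .appR (ih _)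

abbrev Star : L → L → Prop := Relation.ReflTransGen LStep

theorem Plus.map {F : L → L} (hF : ∀ a b, LStep a b → LStep (F a) (F b)) {t t' : L}
    (h : LStepPlus t t') : LStepPlus (F t) (F t') := by
  induction h with
  | single h => exact .single (hF _ _ h)
  | tail _ h ih => exact .tail ih (hF _ _ h)
theorem Star.map {F : L → L} (hF : ∀ a b, LStep a b → LStep (F a) (F b)) {t t' : L}
    (h : Star t t') : Star (F t) (F t') := by
  induction h with
  | refl => exact .refl
  | tail _ h ih => exact .tail ih (hF _ _ h)
theorem Plus.lam {t t'} (h : LStepPlus t t') : LStepPlus (.lam t) (.lam t') :=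
  Plus.map (F := L.lam) (fun _ _ => LStep.lam) h
theorem Plus.appL {t t' s} (h : LStepPlus t t') : LStepPlus (.app t s) (.app t' s) :=
  Plus.map (F := fun x => L.app x s) (fun _ _ => LStep.appL) h
theorem Plus.appR {t s s'} (h : LStepPlus s s') : LStepPlus (.app t s) (.app t s') :=
  Plus.map (F := L.app t) (fun _ _ => LStep.appR) h
theorem Star.lam {t t'} (h : Star t t') : Star (.lam t) (.lam t') :=
  Star.map (F := L.lam) (fun _ _ => LStep.lam) h
theorem Star.app {t t' s s'} (h : Star t t') (h' : Star s s') : Star (.app t s) (.app t' s') :=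
  (Star.map (F := fun x => L.app x s) (fun _ _ => LStep.appL) h).trans
    (Star.map (F := L.app t') (fun _ _ => LStep.appR) h')
theorem Plus.rename {t t'} (h : LStepPlus t t') (f : ℕ → ℕ) :
    LStepPlus (t.rename f) (t'.rename f) :=
  Plus.map (F := L.rename f) (fun _ _ h => h.rename f) h

theorem L.ren_sub (r : L) {g h : ℕ → ℕ} {τ : ℕ → L} (H : ∀ j, τ (g j) = .var (h j)) :
    (r.rename g).subst τ = r.rename h := by
  rw [L.rename_eq_subst r h]; exact L.rename_subst r H

/-! ### Induction on source terms -/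

theorem Tm.ind {P : Tm → Prop}
    (var : ∀ n, P (.var n)) (lam : ∀ t, P t → P (.lam t))
    (app : ∀ t s, P t → P s → P (.app t s)) (pair : ∀ t s, P t → P s → P (.pair t s))
    (proj1 : ∀ t, P t → P (.proj1 t)) (proj2 : ∀ t, P t → P (.proj2 t))
    (inl : ∀ t, P t → P (.inl t)) (inr : ∀ t, P t → P (.inr t))
    (case : ∀ t a b, P t → P a → P b → P (.case t a b))
    (box : ∀ ts s, (∀ t ∈ ts, P t) → P s → P (.box ts s)) : ∀ t, P t := by
  intro t
  refine Tm.rec (motive_1 := P) (motive_2 := fun ts => ∀ t ∈ ts, P t)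
    var lam app pair proj1 proj2 inl inr case box ?_ ?_ t
  · simp
  · intro a l ha hl x hx
    rcases List.mem_cons.1 hx with rfl | h
    · exact ha
    · exact hl _ h

theorem Tm.rename_box (f : ℕ → ℕ) (ts : List Tm) (s : Tm) :
    (Tm.box ts s).rename f = .box (ts.map (Tm.rename f)) (s.rename (liftRen ts.length f)) := by
  rw [Tm.rename]; simp

theorem Tm.subst_box (σ : ℕ → Tm) (ts : List Tm) (s : Tm) :
    (Tm.box ts s).subst σ = .box (ts.map (Tm.subst σ)) (s.subst (liftSub ts.length σ)) := by
  rw [Tm.subst]; simp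

/-! ### colon and renamings of source terms -/

theorem lift1_comp {f g h : ℕ → ℕ} (H : ∀ j, f (g j) = h j) (j : ℕ) :
    lift1 f (liftRen 1 g j) = lift1 h j := by
  cases j <;> simp [lift1, liftRen, H]

theorem sh_comp {f g h : ℕ → ℕ} (d : ℕ) (H : ∀ j, f (g j) = h j) (j : ℕ) :
    sh d f (g j) = sh d h j := by simp [sh, H]

theorem colonBox_rename (ts : List Tm) {f g h : ℕ → ℕ} (H : ∀ j, f (g j) = h j)
    (ih : ∀ t ∈ ts, ∀ {f g h : ℕ → ℕ} {r : L}, (∀ j, f (g j) = h j) →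
      colon f (t.rename g) r = colon h t r) : ∀ (d : ℕ) (s' r : L),
    colonBox f d s' (ts.map (Tm.rename g)) r = colonBox h d s' ts r := by
  induction ts with
  | nil => intro d s' r; simp [colonBox]
  | cons t ts iht =>
    intro d s' r
    simp only [List.map_cons, colonBox]
    rw [ih t (by simp) (sh_comp d H), iht (fun t ht => ih t (by simp [ht]))]

theorem colon_rename (t : Tm) : ∀ {f g h : ℕ → ℕ} {r : L}, (∀ j, f (g j) = h j) →
    colon f (t.rename g) r = colon h t r := by
  induction t using Tm.ind with
  | var n => intro f g h r H; simp [Tm.rename, colon, H]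
  | lam t ih =>
    intro f g h r H; simp only [Tm.rename, colon, mcps]
    rw [ih (sh_comp 1 (lift1_comp H))]
  | app t s ih1 ih2 =>
    intro f g h r H; simp only [Tm.rename, colon, mcps]
    rw [ih1 H, ih2 (sh_comp 1 (sh_comp 1 H))]
  | pair t s ih1 ih2 =>
    intro f g h r H; simp only [Tm.rename, colon, mcps]
    rw [ih1 (sh_comp 1 (sh_comp 1 H)), ih2 (sh_comp 1 (sh_comp 1 H))]
  | proj1 t ih => intro f g h r H; simp only [Tm.rename, colon]; rw [ih H]
  | proj2 t ih => intro f g h r H; simp only [Tm.rename, colon]; rw [ih H]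
  | inl t ih =>
    intro f g h r H; simp only [Tm.rename, colon, mcps]; rw [ih (sh_comp 1 (sh_comp 2 H))]
  | inr t ih =>
    intro f g h r H; simp only [Tm.rename, colon, mcps]; rw [ih (sh_comp 1 (sh_comp 2 H))]
  | case t a b ih1 ih2 ih3 =>
    intro f g h r H; simp only [Tm.rename, colon]
    rw [ih1 H, ih2 (lift1_comp (sh_comp 1 H)), ih3 (lift1_comp (sh_comp 1 H))]
  | box ts s ih1 ih2 =>
    intro f g h r H; simp only [Tm.rename_box, colon, mcps, List.length_map]
    rw [ih2 (sh_comp 1 (liftRen_comp1 _ H)), colonBox_rename ts H ih1]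

/-! ### colon and target substitutions that rename the source variables -/

theorem sh_sub {f g : ℕ → ℕ} {τ : ℕ → L} (d : ℕ) (H : ∀ j, τ (f j) = .var (g j)) (j : ℕ) :
    liftSubL d τ (sh d f j) = .var (sh d g j) := by
  simp [liftSubL, sh, H, L.rename]

theorem lift1_sub {f g : ℕ → ℕ} {τ : ℕ → L} (H : ∀ j, τ (f j) = .var (g j)) (j : ℕ) :
    liftSubL 1 τ (lift1 f j) = .var (lift1 g j) := by
  cases j <;> simp [liftSubL, lift1, H, L.rename]

theorem liftRen_sub {f g : ℕ → ℕ} {τ : ℕ → L} (n : ℕ) (H : ∀ j, τ (f j) = .var (g j)) (j : ℕ) :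
    liftSubL n τ (liftRen n f j) = .var (liftRen n g j) := by
  unfold liftRen
  by_cases hj : j < n
  · simp [hj, liftSubL]
  · simp [hj, liftSubL, H, L.rename]

theorem colonBox_sub (ts : List Tm)
    (ih : ∀ t ∈ ts, ∀ {f g : ℕ → ℕ} {τ : ℕ → L} {r : L}, (∀ j, τ (f j) = .var (g j)) →
      (colon f t r).subst τ = colon g t (r.subst τ)) :
    ∀ {f g : ℕ → ℕ} {τ : ℕ → L} {d d' : ℕ} {s' r : L}, (∀ j, τ (sh d f j) = .var (sh d' g j)) →
    (colonBox f d s' ts r).subst τ =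
      colonBox g d' (s'.subst (liftSubL ts.length τ)) ts (r.subst τ) := by
  induction ts with
  | nil => intro f g τ d d' s' r H; simp [colonBox, L.subst, liftSubL_zero]
  | cons t ts iht =>
    intro f g τ d d' s' r H
    simp only [colonBox, List.length_cons]
    rw [ih t (by simp) H]
    simp only [L.subst]
    rw [iht (fun t ht => ih t (by simp [ht])) (d' := d' + 1) (g := g), liftSubL_liftSubL,
      L.rename_lift, Nat.add_comm 1]
    exact sh_sub 1 H

theorem colon_sub (t : Tm) : ∀ {f g : ℕ → ℕ} {τ : ℕ → L} {r : L}, (∀ j, τ (f j) = .var (g j)) →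
    (colon f t r).subst τ = colon g t (r.subst τ) := by
  have v0 : ∀ τ, liftSubL 1 τ 0 = .var 0 := fun τ => by simp [liftSubL]
  induction t using Tm.ind with
  | var n => intro f g τ r H; simp [L.subst, colon, H]
  | lam t ih =>
    intro f g τ r H; simp only [colon, mcps, L.subst]
    rw [ih (sh_sub 1 (lift1_sub H))]; simp [L.subst, v0]
  | app t s ih1 ih2 =>
    intro f g τ r H; simp only [colon, mcps]
    rw [ih1 H]; simp only [L.subst]
    rw [ih2 (sh_sub 1 (sh_sub 1 H)), L.rename_lift]; simp [L.subst, v0]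
  | pair t s ih1 ih2 =>
    intro f g τ r H; simp only [colon, mcps, L.subst]
    rw [ih1 (sh_sub 1 (sh_sub 1 H)), ih2 (sh_sub 1 (sh_sub 1 H))]; simp [L.subst, v0]
  | proj1 t ih =>
    intro f g τ r H; simp only [colon]; rw [ih H]
    simp only [L.subst, liftSubL_liftSubL, L.rename_lift]; simp [liftSubL]
  | proj2 t ih =>
    intro f g τ r H; simp only [colon]; rw [ih H]
    simp only [L.subst, liftSubL_liftSubL, L.rename_lift]; simp [liftSubL]
  | inl t ih =>
    intro f g τ r H; simp only [colon, mcps, L.subst, liftSubL_liftSubL]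
    have := @ih (sh 1 (sh 2 f)) (sh 1 (sh 2 g)) (liftSubL (1+1+1) τ) (.var 0)
      (by rw [← liftSubL_liftSubL]; exact sh_sub 1 (sh_sub 2 H))
    rw [this]; simp [L.subst, liftSubL]
  | inr t ih =>
    intro f g τ r H; simp only [colon, mcps, L.subst, liftSubL_liftSubL]
    have := @ih (sh 1 (sh 2 f)) (sh 1 (sh 2 g)) (liftSubL (1+1+1) τ) (.var 0)
      (by rw [← liftSubL_liftSubL]; exact sh_sub 1 (sh_sub 2 H))
    rw [this]; simp [L.subst, liftSubL]
  | case t a b ih1 ih2 ih3 =>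
    intro f g τ r H; simp only [colon]
    rw [ih1 H]; simp only [L.subst]
    rw [ih2 (lift1_sub (sh_sub 1 H)), ih3 (lift1_sub (sh_sub 1 H))]
    simp only [liftSubL_liftSubL, L.rename_lift]; simp [liftSubL]
  | box ts s ih1 ih2 =>
    intro f g τ r H; simp only [colon, mcps]
    rw [colonBox_sub ts ih1 (d := 0) (d' := 0) (g := g)]
    · simp only [L.subst]
      rw [ih2 (sh_sub 1 (liftRen_sub _ H))]; simp [L.subst, v0]
    · exact H

theorem mcps_sub (t : Tm) {f g : ℕ → ℕ} {τ : ℕ → L} (H : ∀ j, τ (f j) = .var (g j)) :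
    (mcps f t).subst τ = mcps g t := by
  simp only [mcps, L.subst]
  rw [colon_sub t (sh_sub 1 H)]; simp [L.subst, liftSubL]

theorem mcps_ren (t : Tm) {f g h : ℕ → ℕ} (H : ∀ j, h (f j) = g j) :
    (mcps f t).rename h = mcps g t := by
  rw [L.rename_eq_subst]; exact mcps_sub t (fun j => by rw [H])

theorem mcps_beta (t : Tm) (f : ℕ → ℕ) (r : L) : LStep (.app (mcps f t) r) (colon f t r) := by
  have : colon f t r = (colon (sh 1 f) t (.var 0)).subst1 r := by
    rw [L.subst1_eq, colon_sub (g := f)]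
    · rfl
    · intro j; rfl
  rw [this, mcps]; exact .beta

/-! ### monotonicity in the continuation -/

theorem colonBox_mono (ts : List Tm)
    (ih : ∀ t ∈ ts, ∀ {f : ℕ → ℕ} {r r' : L}, LStepPlus r r' →
      LStepPlus (colon f t r) (colon f t r')) :
    ∀ {f : ℕ → ℕ} {d : ℕ} {s' r r' : L}, LStepPlus r r' →
      LStepPlus (colonBox f d s' ts r) (colonBox f d s' ts r') := by
  induction ts with
  | nil => intro f d s' r r' H; simp only [colonBox]; exact Plus.appL H
  | cons t ts iht =>
    intro f d s' r r' H; simp only [colonBox]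
    exact ih t (by simp) (Plus.lam (iht (fun t ht => ih t (by simp [ht])) (Plus.rename H _)))

theorem colon_mono (t : Tm) : ∀ {f : ℕ → ℕ} {r r' : L}, LStepPlus r r' →
    LStepPlus (colon f t r) (colon f t r') := by
  induction t using Tm.ind with
  | var n => intro f r r' H; simp only [colon]; exact Plus.appR H
  | lam t ih => intro f r r' H; simp only [colon]; exact Plus.appL H
  | app t s ih1 ih2 =>
    intro f r r' H; simp only [colon]; exact ih1 (Plus.lam (Plus.appR (Plus.rename H _)))
  | pair t s ih1 ih2 => intro f r r' H; simp only [colon]; exact Plus.appL H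
  | proj1 t ih =>
    intro f r r' H; simp only [colon]
    exact ih (Plus.lam (Plus.appR (Plus.lam (Plus.lam (Plus.appR (Plus.rename H _))))))
  | proj2 t ih =>
    intro f r r' H; simp only [colon]
    exact ih (Plus.lam (Plus.appR (Plus.lam (Plus.lam (Plus.appR (Plus.rename H _))))))
  | inl t ih => intro f r r' H; simp only [colon]; exact Plus.appL H
  | inr t ih => intro f r r' H; simp only [colon]; exact Plus.appL H
  | case t a b ih1 ih2 ih3 =>
    intro f r r' H; simp only [colon]
    exact ih1 (Plus.lam (Relation.TransGen.trans
      (Plus.appL (Plus.appR (Plus.lam (ih2 (Plus.rename H _)))))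
      (Plus.appR (Plus.lam (ih3 (Plus.rename H _))))))
  | box ts s ih1 ih2 => intro f r r' H; simp only [colon]; exact colonBox_mono ts ih1 H

theorem colon_mono_star (t : Tm) {f : ℕ → ℕ} {r r' : L} (H : Star r r') :
    Star (colon f t r) (colon f t r') := by
  rcases Relation.reflTransGen_iff_eq_or_transGen.1 H with h | h
  · rw [h]
  · exact (colon_mono t h).to_reflTransGen

theorem colonBox_body (ts : List Tm) : ∀ {f : ℕ → ℕ} {d : ℕ} {s' s'' r : L}, LStepPlus s' s'' →
      LStepPlus (colonBox f d s' ts r) (colonBox f d s'' ts r) := by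
  induction ts with
  | nil => intro f d s' s'' r H; simp only [colonBox]; exact Plus.appR H
  | cons t ts iht =>
    intro f d s' s'' r H; simp only [colonBox]
    exact colon_mono t (Plus.lam (iht H))

theorem colonBox_body_star (ts : List Tm) {f : ℕ → ℕ} {d : ℕ} {s' s'' r : L} (H : Star s' s'') :
      Star (colonBox f d s' ts r) (colonBox f d s'' ts r) := by
  rcases Relation.reflTransGen_iff_eq_or_transGen.1 H with h | h
  · rw [h]
  · exact (colonBox_body ts h).to_reflTransGen

/-! ### The substitution lemma -/

/-- The target substitution `τ` simulates the source substitution `σ`. -/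
def Sim (f : ℕ → ℕ) (τ : ℕ → L) (σ : ℕ → Tm) (g : ℕ → ℕ) : Prop :=
  ∀ (h : ℕ → ℕ) (j : ℕ) (r : L),
    Star (.app ((τ (f j)).rename h) r) (colon (fun k => h (g k)) (σ j) r)

theorem Sim.sh {f g τ σ} (d : ℕ) (H : Sim f τ σ g) :
    Sim (sh d f) (liftSubL d τ) σ (sh d g) := by
  intro h j r
  have := H (fun k => h (k + d)) j r
  have e : (liftSubL d τ (IEL.sh d f j)).rename h = (τ (f j)).rename (fun k => h (k + d)) := by
    unfold liftSubL IEL.sh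
    rw [if_neg (by omega), Nat.add_sub_cancel]
    exact L.rename_rename _ (fun _ => rfl)
  rw [e]; exact this

theorem Sim.liftRen {f g τ σ} (n : ℕ) (H : Sim f τ σ g) :
    Sim (liftRen n f) (liftSubL n τ) (liftSub n σ) (liftRen n g) := by
  intro h j r
  by_cases hj : j < n
  · simp only [IEL.liftRen, liftSubL, liftSub, hj, if_true, colon, L.rename]
    exact .refl
  · have := H (fun k => h (k + n)) (j - n) r
    have e : (liftSubL n τ (IEL.liftRen n f j)).rename h
        = (τ (f (j - n))).rename (fun k => h (k + n)) := by
      simp only [liftSubL, IEL.liftRen, hj, if_false]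
      rw [if_neg (by omega), Nat.add_sub_cancel]
      exact L.rename_rename _ (fun _ => rfl)
    rw [e]
    simp only [liftSub, hj, if_false]
    rw [colon_rename (h := fun k => h (g k + n))]
    · exact this
    · intro k; simp [IEL.liftRen]

theorem liftRen_one (f : ℕ → ℕ) : liftRen 1 f = lift1 f := by
  funext j; cases j <;> simp [liftRen, lift1]

theorem Sim.lift1 {f g τ σ} (H : Sim f τ σ g) :
    Sim (lift1 f) (liftSubL 1 τ) (liftSub 1 σ) (lift1 g) := by
  rw [← liftRen_one, ← liftRen_one]; exact H.liftRen 1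

theorem colonBox_subst (ts : List Tm)
    (ih : ∀ t ∈ ts, ∀ {f g : ℕ → ℕ} {τ : ℕ → L} {σ : ℕ → Tm} {r : L}, Sim f τ σ g →
      Star ((colon f t r).subst τ) (colon g (t.subst σ) (r.subst τ))) :
    ∀ {f g : ℕ → ℕ} {τ : ℕ → L} {σ : ℕ → Tm} {d : ℕ} {s' s'' r : L},
    Sim (sh d f) τ σ (sh d g) → Star (s'.subst (liftSubL ts.length τ)) s'' →
    Star ((colonBox f d s' ts r).subst τ)
      (colonBox g d s'' (ts.map (Tm.subst σ)) (r.subst τ)) := by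
  induction ts with
  | nil =>
    intro f g τ σ d s' s'' r H hs
    simp only [colonBox, L.subst, List.map_nil, List.length_nil, liftSubL_zero] at hs ⊢
    exact Star.app .refl hs
  | cons t ts iht =>
    intro f g τ σ d s' s'' r H hs
    simp only [colonBox, List.map_cons]
    refine (ih t (by simp) H).trans (colon_mono_star _ ?_)
    simp only [L.subst]
    apply Star.lam
    rw [← L.rename_lift]
    apply iht (fun t ht => ih t (by simp [ht]))
    · exact H.sh 1
    · rw [liftSubL_liftSubL, Nat.add_comm 1]; exact hs

theorem colon_subst (t : Tm) : ∀ {f g : ℕ → ℕ} {τ : ℕ → L} {σ : ℕ → Tm} {r : L}, Sim f τ σ g →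
    Star ((colon f t r).subst τ) (colon g (t.subst σ) (r.subst τ)) := by
  have v0 : ∀ τ, liftSubL 1 τ 0 = .var 0 := fun τ => by simp [liftSubL]
  have key : ∀ t : Tm, (∀ {f g : ℕ → ℕ} {τ : ℕ → L} {σ : ℕ → Tm} {r : L}, Sim f τ σ g →
      Star ((colon f t r).subst τ) (colon g (t.subst σ) (r.subst τ))) →
      ∀ {f g : ℕ → ℕ} {τ : ℕ → L} {σ : ℕ → Tm}, Sim f τ σ g →
      Star ((mcps f t).subst τ) (mcps g (t.subst σ)) := by
    intro t ih f g τ σ H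
    simp only [mcps, L.subst]
    have := ih (r := .var 0) (H.sh 1)
    simp only [L.subst, v0] at this
    exact this.lam
  induction t using Tm.ind with
  | var n =>
    intro f g τ σ r H
    simp only [L.subst, Tm.subst, colon]
    have := H id n (r.subst τ)
    rw [L.rename_id (f := id) _ (fun _ => rfl)] at this
    exact this
  | lam t ih =>
    intro f g τ σ r H; simp only [Tm.subst, colon, L.subst]
    exact Star.app .refl (Star.lam (key t ih H.lift1))
  | app t s ih1 ih2 =>
    intro f g τ σ r H; simp only [Tm.subst, colon]
    refine (ih1 H).trans (colon_mono_star _ ?_)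
    simp only [L.subst, v0, L.rename_lift]
    exact Star.lam (Star.app (Star.app .refl (key s ih2 (H.sh 1))) .refl)
  | pair t s ih1 ih2 =>
    intro f g τ σ r H; simp only [Tm.subst, colon, L.subst, v0]
    exact Star.app .refl
      (Star.lam (Star.app (Star.app .refl (key t ih1 (H.sh 1))) (key s ih2 (H.sh 1))))
  | proj1 t ih =>
    intro f g τ σ r H; simp only [Tm.subst, colon]
    refine (ih H).trans (colon_mono_star _ ?_)
    simp only [L.subst, liftSubL_liftSubL, L.rename_lift]
    simp [liftSubL, Relation.ReflTransGen.refl]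
  | proj2 t ih =>
    intro f g τ σ r H; simp only [Tm.subst, colon]
    refine (ih H).trans (colon_mono_star _ ?_)
    simp only [L.subst, liftSubL_liftSubL, L.rename_lift]
    simp [liftSubL, Relation.ReflTransGen.refl]
  | inl t ih =>
    intro f g τ σ r H; simp only [Tm.subst, colon, L.subst, liftSubL_liftSubL]
    have e : liftSubL (1 + 1) τ 1 = .var 1 := by simp [liftSubL]
    rw [e]
    exact Star.app .refl (Star.lam (Star.lam (Star.app .refl (key t ih (H.sh 2)))))
  | inr t ih =>
    intro f g τ σ r H; simp only [Tm.subst, colon, L.subst, liftSubL_liftSubL]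
    have e : liftSubL (1 + 1) τ 0 = .var 0 := by simp [liftSubL]
    rw [e]
    exact Star.app .refl (Star.lam (Star.lam (Star.app .refl (key t ih (H.sh 2)))))
  | case t a b ih1 ih2 ih3 =>
    intro f g τ σ r H; simp only [Tm.subst, colon]
    refine (ih1 H).trans (colon_mono_star _ ?_)
    simp only [L.subst, v0]
    have h2 := ih2 (r := r.rename (· + 2)) (H.sh 1).lift1
    have h3 := ih3 (r := r.rename (· + 2)) (H.sh 1).lift1
    have e : (r.rename (· + 2)).subst (liftSubL 1 (liftSubL 1 τ))
        = (r.subst τ).rename (· + 2) := by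
      rw [liftSubL_liftSubL]; exact L.rename_lift r 2 τ
    rw [e] at h2 h3
    exact Star.lam (Star.app (Star.app .refl (Star.lam h2)) (Star.lam h3))
  | box ts s ih1 ih2 =>
    intro f g τ σ r H; simp only [Tm.subst_box, colon, List.length_map]
    exact colonBox_subst ts ih1 (d := 0) H (key s ih2 (H.liftRen _))

theorem mcps_subst (t : Tm) {f g : ℕ → ℕ} {τ : ℕ → L} {σ : ℕ → Tm} (H : Sim f τ σ g) :
    Star ((mcps f t).subst τ) (mcps g (t.subst σ)) := by
  simp only [mcps, L.subst]
  have := colon_subst t (r := .var 0) (H.sh 1)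
  simp only [L.subst] at this
  exact this.lam

theorem Sim.one (f : ℕ → ℕ) (s : Tm) :
    Sim (IEL.lift1 f) (one (mcps f s))
      (fun j => match j with | 0 => s | j+1 => .var j) f := by
  intro h j r
  cases j with
  | zero =>
    simp only [IEL.lift1, IEL.one]
    rw [mcps_ren s (g := fun k => h (f k)) (fun _ => rfl)]
    exact .single (mcps_beta _ _ _)
  | succ j => simp only [IEL.lift1, IEL.one, L.rename, colon]; exact .refl

theorem colon_subst1 (t s : Tm) (f : ℕ → ℕ) (r : L) :
    Star ((colon (lift1 f) t (r.rename (· + 1))).subst (one (mcps f s)))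
      (colon f (t.subst1 s) r) := by
  have := colon_subst t (r := r.rename (· + 1)) (Sim.one f s)
  rw [L.rename_one] at this
  exact this

theorem beta_eq {t s u : L} (h : t.subst (one s) = u) : LStep (.app (.lam t) s) u := by
  rw [← h]; exact .beta

theorem sh_one (s : L) (d : ℕ) (f : ℕ → ℕ) (j : ℕ) : one s (sh (d + 1) f j) = .var (sh d f j) := rfl

/-! ### Box/box -/

theorem boxbox_core {f : ℕ → ℕ} {d : ℕ} {S S'' V : L} {l₂ : List Tm} : ∀ (us : List Tm) (e : ℕ)
    (r r' K : L),
    K = .lam ((colonBox f (d + 1) S l₂ (r.rename (· + 1)))) →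
    r' = r.rename (· + e) →
    Star (S.subst (liftSubL l₂.length
      (fun j => match j with | 0 => V | j + 1 => .var (j + (e + us.length))))) S'' →
    LStepPlus (colonBox (sh d f) e V us (K.rename (· + e)))
      (colonBox f (d + e) S'' (us ++ l₂) r') := by
  intro us
  induction us with
  | nil =>
    intro e r r' K hK hr hS
    subst hK hr
    simp only [colonBox, L.rename, List.nil_append, List.length_nil, Nat.add_zero] at hS ⊢
    refine Relation.TransGen.trans_left (.single .beta) ?_
    rw [L.subst1_eq, L.rename_subst (f := liftRen 1 (· + e)) (τ := one V)
      (τ' := (fun j => match j with | 0 => V | j + 1 => .var (j + e)))]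
    · rw [colonBox_sub l₂ (fun t _ => colon_sub t) (g := f) (d' := d + e)]
      · rw [L.ren_sub (g := (· + 1)) (h := (· + e)) r (fun _ => rfl)]
        exact colonBox_body_star _ hS
      · intro j; simp only [sh]
        show L.var (f j + d + e) = _
        congr 1; omega
    · intro j; cases j with
      | zero => rfl
      | succ j => simp [liftRen, one]
  | cons u us ih =>
    intro e r r' K hK hr hS
    simp only [List.cons_append, colonBox]
    have e1 : sh e (sh d f) = sh (d + e) f := by funext j; simp [sh]; omega
    rw [e1]
    apply colon_mono
    apply Plus.lam
    rw [L.rename_rename (h := (· + (e + 1)))]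
    · apply ih (e + 1) r _ K hK
      · rw [hr]; exact L.rename_rename _ (fun _ => rfl)
      · rw [List.length_cons] at hS
        rw [show e + 1 + us.length = e + (us.length + 1) by omega]; exact hS
    · intro j; rfl

theorem boxbox_outer {f : ℕ → ℕ} {S S'' : L} {us l₂ : List Tm} {v : Tm} : ∀ (l₁ : List Tm) (d : ℕ)
    (r : L),
    Star (S.subst (liftSubL l₂.length
      (fun j => match j with
        | 0 => mcps (liftRen us.length (sh (d + l₁.length) f)) v
        | j + 1 => .var (j + us.length)))) S'' →
    LStepPlus (colonBox f d S (l₁ ++ (.box us v) :: l₂) r)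
      (colonBox f d S'' (l₁ ++ us ++ l₂) r) := by
  intro l₁
  induction l₁ with
  | nil =>
    intro d r hS
    simp only [List.nil_append, colonBox, colon, List.length_nil, Nat.add_zero] at hS ⊢
    have := boxbox_core (f := f) (d := d) (S := S) (S'' := S'') (l₂ := l₂)
      (V := mcps (liftRen us.length (sh d f)) v) us 0 r r _ rfl
      (L.rename_id _ (fun _ => rfl)).symm (by rw [Nat.zero_add]; exact hS)
    rw [L.rename_id (f := (· + 0)) _ (fun _ => rfl)] at this
    exact this
  | cons t l₁ ih =>
    intro d r hS
    simp only [List.cons_append, colonBox]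
    apply colon_mono
    apply Plus.lam
    apply ih
    rw [List.length_cons] at hS
    rw [show d + 1 + l₁.length = d + (l₁.length + 1) by omega]; exact hS

theorem boxSim (f : ℕ → ℕ) (a m i : ℕ) (v : Tm) :
    Sim (liftRen (a + 1 + i) f)
      (liftSubL i (fun j => match j with
        | 0 => mcps (liftRen m (sh a f)) v
        | j + 1 => .var (j + m)))
      (boxSigma i m (a + 1 + i) v) (liftRen (a + m + i) f) := by
  intro h j r
  rcases Nat.lt_trichotomy j i with hj | hj | hj
  · have e1 : liftRen (a + 1 + i) f j = j := by simp [liftRen]; omega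
    have e2 : liftRen (a + m + i) f j = j := by simp [liftRen]; omega
    rw [e1]
    simp only [boxSigma, liftSubL, hj, if_true, L.rename, colon, e2]
    exact .refl
  · subst hj
    have e1 : liftRen (a + 1 + j) f j = j := by
      unfold liftRen; rw [if_pos (by omega)]
    rw [e1]
    simp only [boxSigma, liftSubL, lt_irrefl, if_false, if_true, Nat.sub_self]
    rw [L.rename_rename (h := fun k => h (k + j)) _ (fun _ => rfl)]
    rw [colon_rename v (fun _ => rfl)]
    rw [mcps_ren v (g := fun k => h (liftRen (a + m + j) f (boxRho j m (a + 1 + j) k)))]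
    · exact .single (mcps_beta _ _ _)
    · intro k
      congr 1
      unfold liftRen boxRho sh
      by_cases hk : k < m
      · simp only [hk, if_true]; rw [if_pos (by omega)]; omega
      · simp only [hk, if_false]; rw [if_neg (by omega)]
        rw [show k + (a + 1 + j) - 1 - (a + m + j) = k - m by omega]; omega
  · have hs : boxSigma i m (a + 1 + i) v j = .var (j + m - 1) := by
      unfold boxSigma; rw [if_neg (by omega), if_neg (by omega)]
    rw [hs]
    have key : ∀ q, i < q → liftSubL i (fun j => match j with
        | 0 => mcps (liftRen m (sh a f)) v
        | j + 1 => .var (j + m)) q = .var (q + m - 1) := by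
      intro q hq
      obtain ⟨p, rfl⟩ : ∃ p, q = p + 1 + i := ⟨q - 1 - i, by omega⟩
      simp only [liftSubL]
      rw [if_neg (by omega), Nat.add_sub_cancel]
      simp only [L.rename]; congr 1; omega
    rw [key]
    · simp only [L.rename, colon]
      have : liftRen (a + 1 + i) f j + m - 1 = liftRen (a + m + i) f (j + m - 1) := by
        unfold liftRen
        by_cases hk : j < a + 1 + i
        · rw [if_pos hk, if_pos (by omega)]
        · rw [if_neg hk, if_neg (by omega),
            show j + m - 1 - (a + m + i) = j - (a + 1 + i) by omega]; omega
      rw [this]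
    · unfold liftRen; split <;> omega

/-! ### Simulation -/

theorem root_sim {t s : Tm} (h : DRed t s) (f : ℕ → ℕ) (r : L) :
    LStepPlus (colon f t r) (colon f s r) := by
  cases h with
  | @beta t s =>
    simp only [colon]
    refine .head (b := .app (.app (.lam (mcps (lift1 f) t)) (mcps f s)) r) (beta_eq ?_) ?_
    · simp only [L.subst]
      rw [L.rename_one, mcps_sub (g := f)]
      · rfl
      · intro j; rfl
    refine .head (LStep.appL .beta) ?_
    rw [L.subst1_eq]
    exact Relation.TransGen.tail' (Star.app (mcps_subst t (Sim.one f s)) .refl) (mcps_beta _ _ _)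
  | @projPair1 _ u =>
    simp only [colon]
    have er : ∀ X, (r.rename (· + 3)).subst (liftSubL (1 + 1) (one X)) = r.rename (· + 2) :=
      fun X => L.ren_sub r (fun j => by simp [liftSubL, one, L.rename])
    have er2 : ∀ X, (r.rename (· + 2)).subst (liftSubL 1 (one X)) = r.rename (· + 1) :=
      fun X => L.ren_sub r (fun j => by simp [liftSubL, one, L.rename])
    have em : ∀ (u : Tm) X, (mcps (sh 1 f) u).subst (one X) = mcps f u :=
      fun u X => mcps_sub u (fun j => rfl)
    have v1 : ∀ X, liftSubL (1 + 1) (one X) 1 = .var 1 := fun X => by simp [liftSubL, one, L.rename]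
    refine .head (b := .app (.lam (.app (.app (.var 0) (mcps (sh 1 f) s)) (mcps (sh 1 f) u)))
      (.lam (.lam (.app (.var 1) (r.rename (· + 2)))))) (beta_eq ?_) ?_
    · simp only [L.subst, liftSubL_liftSubL, er, v1]; rfl
    refine .head (b := .app (.app (.lam (.lam (.app (.var 1) (r.rename (· + 2))))) (mcps f s))
      (mcps f u)) (beta_eq ?_) ?_
    · simp only [L.subst, em]; rfl
    refine .head (b := .app (.lam (.app ((mcps f s).rename (· + 1)) (r.rename (· + 1)))) (mcps f u))
      (LStep.appL (beta_eq ?_)) ?_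
    · simp only [L.subst, er2]; rfl
    refine .head (b := .app (mcps f s) r) (beta_eq ?_) (.single (mcps_beta _ _ _))
    · simp only [L.subst, L.rename_one]
  | @projPair2 u _ =>
    simp only [colon]
    have er : ∀ X, (r.rename (· + 3)).subst (liftSubL (1 + 1) (one X)) = r.rename (· + 2) :=
      fun X => L.ren_sub r (fun j => by simp [liftSubL, one, L.rename])
    have er2 : ∀ X, (r.rename (· + 2)).subst (liftSubL 1 (one X)) = r.rename (· + 1) :=
      fun X => L.ren_sub r (fun j => by simp [liftSubL, one, L.rename])
    have em : ∀ (u : Tm) X, (mcps (sh 1 f) u).subst (one X) = mcps f u :=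
      fun u X => mcps_sub u (fun j => rfl)
    have v0 : ∀ X, liftSubL (1 + 1) (one X) 0 = .var 0 := fun X => by simp [liftSubL, one, L.rename]
    refine .head (b := .app (.lam (.app (.app (.var 0) (mcps (sh 1 f) u)) (mcps (sh 1 f) s)))
      (.lam (.lam (.app (.var 0) (r.rename (· + 2)))))) (beta_eq ?_) ?_
    · simp only [L.subst, liftSubL_liftSubL, er, v0]; rfl
    refine .head (b := .app (.app (.lam (.lam (.app (.var 0) (r.rename (· + 2))))) (mcps f u))
      (mcps f s)) (beta_eq ?_) ?_
    · simp only [L.subst, em]; rfl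
    refine .head (b := .app (.lam (.app (.var 0) (r.rename (· + 1)))) (mcps f s))
      (LStep.appL (beta_eq ?_)) ?_
    · simp only [L.subst, er2]; rfl
    refine .head (b := .app (mcps f s) r) (beta_eq ?_) (.single (mcps_beta _ _ _))
    · simp only [L.subst, L.rename_one]; rfl
  | @caseInl t a b =>
    simp only [colon]
    have ea : ∀ (c : Tm) (I : L), (colon (lift1 (sh 1 f)) c (r.rename (· + 2))).subst
        (liftSubL 1 (one I)) = colon (lift1 f) c (r.rename (· + 1)) := by
      intro c I
      rw [colon_sub c (g := lift1 f), L.ren_sub r (h := (· + 1))]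
      · intro j; simp [liftSubL, one, L.rename]
      · exact lift1_sub (fun _ => rfl)
    have em : ∀ X, (mcps (sh 2 f) t).subst (liftSubL 1 (one X)) = mcps (sh 1 f) t :=
      fun X => mcps_sub t (fun j => by simp [liftSubL, one, L.rename, sh])
    have em1 : ∀ X, (mcps (sh 1 f) t).subst (one X) = mcps f t :=
      fun X => mcps_sub t (fun j => rfl)
    refine .head (b := .app (.app (.lam (.lam (.app (.var 1) (mcps (sh 2 f) t))))
      (.lam (colon (lift1 f) a (r.rename (· + 1)))))
      (.lam (colon (lift1 f) b (r.rename (· + 1))))) (beta_eq ?_) ?_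
    · simp only [L.subst, ea]; rfl
    refine .head (b := .app (.lam (.app ((L.lam (colon (lift1 f) a (r.rename (· + 1)))).rename (· + 1)) (mcps (sh 1 f) t)))
      (.lam (colon (lift1 f) b (r.rename (· + 1))))) (LStep.appL (beta_eq ?_)) ?_
    · simp only [L.subst, em]; rfl
    refine .head (b := .app (.lam (colon (lift1 f) a (r.rename (· + 1)))) (mcps f t))
      (beta_eq ?_) ?_
    · simp only [L.subst, em1, L.rename_one]
    exact Relation.TransGen.head' .beta (colon_subst1 a t f r)
  | @caseInr t a b =>
    simp only [colon]
    have ea : ∀ (c : Tm) (I : L), (colon (lift1 (sh 1 f)) c (r.rename (· + 2))).subst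
        (liftSubL 1 (one I)) = colon (lift1 f) c (r.rename (· + 1)) := by
      intro c I
      rw [colon_sub c (g := lift1 f), L.ren_sub r (h := (· + 1))]
      · intro j; simp [liftSubL, one, L.rename]
      · exact lift1_sub (fun _ => rfl)
    have em : ∀ X, (mcps (sh 2 f) t).subst (liftSubL 1 (one X)) = mcps (sh 1 f) t :=
      fun X => mcps_sub t (fun j => by simp [liftSubL, one, L.rename, sh])
    have em1 : ∀ X, (mcps (sh 1 f) t).subst (one X) = mcps f t :=
      fun X => mcps_sub t (fun j => rfl)
    refine .head (b := .app (.app (.lam (.lam (.app (.var 0) (mcps (sh 2 f) t))))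
      (.lam (colon (lift1 f) a (r.rename (· + 1)))))
      (.lam (colon (lift1 f) b (r.rename (· + 1))))) (beta_eq ?_) ?_
    · simp only [L.subst, ea]; rfl
    refine .head (b := .app (.lam (.app (.var 0) (mcps (sh 1 f) t)))
      (.lam (colon (lift1 f) b (r.rename (· + 1))))) (LStep.appL (beta_eq ?_)) ?_
    · simp only [L.subst, em]; rfl
    refine .head (b := .app (.lam (colon (lift1 f) b (r.rename (· + 1)))) (mcps f t))
      (beta_eq ?_) ?_
    · simp only [L.subst, em1]; rfl
    exact Relation.TransGen.head' .beta (colon_subst1 b t f r)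
  | @boxBox l₁ l₂ us v b =>
    simp only [colon]
    apply boxbox_outer
    have := mcps_subst b (boxSim f l₁.length us.length l₂.length v)
    simp only [List.length_append, List.length_cons, Nat.zero_add]
    rw [show l₁.length + (l₂.length + 1) = l₁.length + 1 + l₂.length by omega]
    exact this
  | boxVar =>
    simp only [colon, colonBox, mcps]
    have e : sh 0 f = f := rfl
    rw [e]
    apply colon_mono
    have e2 : sh 1 (liftRen [s].length f) 0 = 1 := by simp [sh, liftRen]
    rw [e2]
    exact .head (LStep.lam (LStep.appR (LStep.eta (t := .var 0)))) (.single LStep.eta)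

theorem colonBox_arg {t t' : Tm} (ih : ∀ f r, LStepPlus (colon f t r) (colon f t' r))
    (l₁ l₂ : List Tm) : ∀ (f : ℕ → ℕ) (d : ℕ) (S r : L),
    LStepPlus (colonBox f d S (l₁ ++ t :: l₂) r) (colonBox f d S (l₁ ++ t' :: l₂) r) := by
  induction l₁ with
  | nil => intro f d S r; simp only [List.nil_append, colonBox]; exact ih _ _
  | cons u l₁ ihl =>
    intro f d S r; simp only [List.cons_append, colonBox]
    exact colon_mono u (Plus.lam (ihl _ _ _ _))

theorem step_sim {t s : Tm} (h : StepD t s) : ∀ (f : ℕ → ℕ) (r : L),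
    LStepPlus (colon f t r) (colon f s r) := by
  unfold StepD at h
  induction h with
  | base h => exact root_sim h
  | lam _ ih =>
    intro f r; simp only [colon, mcps]; exact Plus.appR (Plus.lam (Plus.lam (ih _ _)))
  | appL _ ih => intro f r; simp only [colon]; exact ih _ _
  | @appR t _ _ _ ih =>
    intro f r; simp only [colon, mcps]
    exact colon_mono t (Plus.lam (Plus.appL (Plus.appR (Plus.lam (ih _ _)))))
  | pairL _ ih =>
    intro f r; simp only [colon, mcps]
    exact Plus.appR (Plus.lam (Plus.appL (Plus.appR (Plus.lam (ih _ _)))))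
  | pairR _ ih =>
    intro f r; simp only [colon, mcps]
    exact Plus.appR (Plus.lam (Plus.appR (Plus.lam (ih _ _))))
  | proj1 _ ih => intro f r; simp only [colon]; exact ih _ _
  | proj2 _ ih => intro f r; simp only [colon]; exact ih _ _
  | inl _ ih =>
    intro f r; simp only [colon, mcps]
    exact Plus.appR (Plus.lam (Plus.lam (Plus.appR (Plus.lam (ih _ _)))))
  | inr _ ih =>
    intro f r; simp only [colon, mcps]
    exact Plus.appR (Plus.lam (Plus.lam (Plus.appR (Plus.lam (ih _ _)))))
  | case1 _ ih => intro f r; simp only [colon]; exact ih _ _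
  | @case2 t _ _ _ _ ih =>
    intro f r; simp only [colon]
    exact colon_mono t (Plus.lam (Plus.appL (Plus.appR (Plus.lam (ih _ _)))))
  | @case3 t _ _ _ _ ih =>
    intro f r; simp only [colon]
    exact colon_mono t (Plus.lam (Plus.appR (Plus.lam (ih _ _))))
  | boxArg _ ih =>
    intro f r; simp only [colon]
    have := colonBox_arg ih
    simp only [List.length_append, List.length_cons]
    exact this _ _ _ _ _ _
  | boxBody _ ih =>
    intro f r; simp only [colon, mcps]
    exact colonBox_body _ (Plus.lam (ih _ _))

/-- **Simulation of detour reduction by βη-reduction**: if `t >_D s` then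
`(t : r) ⟶⁺_{βη} (s : r)` for every λ-term `r` of simple type theory, and
`t̿ ⟶⁺_{βη} s̿`. -/
theorem colon_mcps_simulate_detour :
    ∀ t s : Tm, StepD t s →
      (∀ r : L, LStepPlus (colon id t r) (colon id s r)) ∧
        LStepPlus (mcps id t) (mcps id s) := by
  intro t s h
  refine ⟨step_sim h id, ?_⟩
  simp only [mcps]
  exact Plus.lam (step_sim h _ _)

end IEL
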